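/- Let f̄(x) = (1/n)∑_{i=1}^n f_i(x) with each f_i convex and L_f-Lipschitz differentiable, and suppose f̄ is restricted strongly convex with respect to its minimizer x* with constant μ_{f̄} > 0. Let W̃ − W be symmetric PSD with null(W̃−W) = span{𝟏}, and for α > 0 define g(X) = ∑_i f_i(x_{(i)}) + (1/(4α))‖X‖²_{W̃−W}. Then g is restricted strongly convex with respect to X* = 𝟏(x*)ᵀ: there exists μ_g > 0 such that ⟨∇g(X) − ∇g(X*), X − X*⟩ ≥ μ_g‖X − X*‖_F² for all X ∈ ℝ^{n×p}; in particular μ_g ≥ min{μ_{f̄} − 2L_f γ, λ̃_min(W̃−W)/(2α(1+1/γ²))} for any γ ∈ (0, μ_{f̄}/(2L_f)). -/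

import Mathlib

open Matrix Finset

/-- Smallest nonzero eigenvalue of a matrix (0 if there is none). -/
noncomputable def lamTildeMin {n : ℕ} (M : Matrix (Fin n) (Fin n) ℝ) : ℝ :=
  sInf {μ : ℝ | 0 < μ ∧ ∃ v : Fin n → ℝ, v ≠ 0 ∧ M.mulVec v = μ • v}

/-- On the orthogonal complement of its kernel, a symmetric positive semidefinite matrix is bounded
below by its smallest nonzero eigenvalue. -/
lemma lamTildeMin_mul_le {n : ℕ} {M : Matrix (Fin n) (Fin n) ℝ} (hM : M.PosSemidef)
    {v : Fin n → ℝ} (hv : ∀ w, M *ᵥ w = 0 → w ⬝ᵥ v = 0) :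
    lamTildeMin M * (v ⬝ᵥ v) ≤ v ⬝ᵥ M *ᵥ v := by
  have hH : M.IsHermitian := hM.isHermitian
  let b := hH.eigenvectorBasis
  have hinner : ∀ x y : Fin n → ℝ,
      x ⬝ᵥ y = ∑ i, (b i).ofLp ⬝ᵥ x * ((b i).ofLp ⬝ᵥ y) := by
    intro x y
    have h := b.sum_inner_mul_inner (WithLp.toLp 2 x) (WithLp.toLp 2 y)
    simp only [EuclideanSpace.inner_eq_star_dotProduct, star_trivial] at h
    rw [dotProduct_comm x y, ← h]
    exact Finset.sum_congr rfl fun i _ => by rw [dotProduct_comm y]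
  have heig : ∀ i, (b i).ofLp ⬝ᵥ M *ᵥ v = hH.eigenvalues i * ((b i).ofLp ⬝ᵥ v) := by
    intro i
    have hT : Mᵀ = M := by simpa [conjTranspose_eq_transpose_of_trivial] using hH.eq
    rw [dotProduct_mulVec, ← mulVec_transpose, hT, hH.mulVec_eigenvectorBasis i, smul_dotProduct,
      smul_eq_mul]
  rw [hinner v v, hinner v (M *ᵥ v), Finset.mul_sum]
  refine Finset.sum_le_sum fun i _ => ?_
  rw [heig i]
  have hmul := hH.mulVec_eigenvectorBasis i
  rcases (hM.eigenvalues_nonneg i).eq_or_lt with h0 | hpos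
  · rw [← h0, zero_smul] at hmul
    simp [show (b i).ofLp ⬝ᵥ v = 0 from hv _ hmul]
  · have hle : lamTildeMin M ≤ hH.eigenvalues i := by
      refine csInf_le ⟨0, fun x hx => hx.1.le⟩ ⟨hpos, (b i).ofLp, fun h => ?_, hmul⟩
      exact b.orthonormal.ne_zero i (by ext j; simp [h])
    nlinarith [mul_le_mul_of_nonneg_right hle (mul_self_nonneg ((b i).ofLp ⬝ᵥ v))]

/-- The smallest nonzero eigenvalue of a nonzero positive semidefinite matrix is positive. -/
lemma lamTildeMin_pos {n : ℕ} {M : Matrix (Fin n) (Fin n) ℝ} (hM : M.PosSemidef) (h0 : M ≠ 0) :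
    0 < lamTildeMin M := by
  have hH : M.IsHermitian := hM.isHermitian
  have hne : {μ : ℝ | 0 < μ ∧ ∃ v : Fin n → ℝ, v ≠ 0 ∧ M.mulVec v = μ • v}.Nonempty := by
    obtain ⟨i, hi⟩ : ∃ i, hH.eigenvalues i ≠ 0 := by
      by_contra! h
      exact h0 (hH.eigenvalues_eq_zero_iff.1 (funext h))
    refine ⟨hH.eigenvalues i, (hM.eigenvalues_nonneg i).lt_of_ne' hi,
      (hH.eigenvectorBasis i).ofLp, fun h => ?_, hH.mulVec_eigenvectorBasis i⟩
    exact hH.eigenvectorBasis.orthonormal.ne_zero i (by ext j; simp [h])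
  have hfin : {μ : ℝ | 0 < μ ∧ ∃ v : Fin n → ℝ, v ≠ 0 ∧ M.mulVec v = μ • v}.Finite := by
    refine (Module.End.finite_hasEigenvalue (Matrix.toLin' M)).subset ?_
    rintro μ ⟨-, v, hv, hμ⟩
    exact Module.End.hasEigenvalue_of_hasEigenvector
      (Module.End.hasEigenvector_iff.2 ⟨Module.End.mem_eigenspace_iff.2 (by simpa using hμ), hv⟩)
  exact (hne.csInf_mem hfin).1

/-- Cauchy–Schwarz lower bound for the Frobenius inner product. -/
lemma neg_mul_le_sum_sum_mul {ι κ : Type*} [Fintype ι] [Fintype κ] (A B : ι → κ → ℝ) {a b : ℝ}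
    (ha : 0 ≤ a) (hb : 0 ≤ b) (hA : ∑ i, ∑ j, A i j ^ 2 ≤ a ^ 2)
    (hB : ∑ i, ∑ j, B i j ^ 2 ≤ b ^ 2) : -(a * b) ≤ ∑ i, ∑ j, A i j * B i j := by
  simp only [← Fintype.sum_prod_type'] at *
  have h := Finset.sum_mul_sq_le_sq_mul_sq univ (fun z : ι × κ => A z.1 z.2) fun z => B z.1 z.2
  refine (abs_le.1 (abs_le_of_sq_le_sq (h.trans ?_) (mul_nonneg ha hb))).1
  rw [mul_pow]
  exact mul_le_mul hA hB (Finset.sum_nonneg fun _ _ => sq_nonneg _) (sq_nonneg a)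

/-- The sum of squares splits into mean and deviation parts. -/
lemma sum_add_sq_of_sum_eq_zero {ι : Type*} [Fintype ι] (c : ℝ) {v : ι → ℝ} (hv : ∑ i, v i = 0) :
    ∑ i, (c + v i) ^ 2 = ∑ _i : ι, c ^ 2 + ∑ i, v i ^ 2 := by
  have h : ∀ i, (c + v i) ^ 2 = c ^ 2 + v i ^ 2 + 2 * c * v i := fun i => by ring
  simp only [h, Finset.sum_add_distrib, ← Finset.mul_sum, hv, mul_zero, add_zero]

/-- The quadratic form of a symmetric matrix annihilating constants ignores constant shifts. -/
lemma dotProduct_mulVec_const_add {n : ℕ} {M : Matrix (Fin n) (Fin n) ℝ} (hM : M.IsSymm)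
    (h1 : ∀ c : ℝ, M *ᵥ (fun _ => c) = 0) (c : ℝ) (v : Fin n → ℝ) :
    ((fun _ => c) + v) ⬝ᵥ M *ᵥ ((fun _ => c) + v) = v ⬝ᵥ M *ᵥ v := by
  rw [mulVec_add, h1, zero_add, add_dotProduct, dotProduct_mulVec, ← mulVec_transpose, hM.eq, h1,
    zero_dotProduct, zero_add]

/-- A gradient (subgradient) inequality makes the gradient map monotone. -/
lemma sum_gradient_mul_nonneg {p : ℕ} {f : (Fin p → ℝ) → ℝ} {g : (Fin p → ℝ) → Fin p → ℝ}
    (h : ∀ x y, f x + ∑ j, g x j * (y j - x j) ≤ f y) (x y : Fin p → ℝ) :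
    0 ≤ ∑ j, (g x j - g y j) * (x j - y j) := by
  have e : ∑ j, (g x j - g y j) * (x j - y j) =
      -(∑ j, g x j * (y j - x j)) - ∑ j, g y j * (x j - y j) := by
    rw [← Finset.sum_neg_distrib, ← Finset.sum_sub_distrib]
    exact Finset.sum_congr rfl fun j _ => by ring
  linarith [h x y, h y x]

/-- The gradient term is bounded below in terms of the consensus part `u` and the deviation `V`. -/
lemma sum_gradient_mul_lower_bound {n p : ℕ}
    {f : Fin n → (Fin p → ℝ) → ℝ} {g : Fin n → (Fin p → ℝ) → (Fin p → ℝ)}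
    (hconv : ∀ i x y, f i x + ∑ j, g i x j * (y j - x j) ≤ f i y)
    {Lf : ℝ} (hLf : 0 < Lf)
    (hLip : ∀ i (a b : Fin p → ℝ),
      Real.sqrt (∑ j, (g i a j - g i b j) ^ 2) ≤ Lf * Real.sqrt (∑ j, (a j - b j) ^ 2))
    {xs : Fin p → ℝ} {μbar : ℝ}
    (hRSC : ∀ x : Fin p → ℝ,
      μbar * ∑ j, (x j - xs j) ^ 2 ≤
        ∑ j, ((1 / (n : ℝ)) * ∑ i, (g i x j - g i xs j)) * (x j - xs j))
    (X : Fin n → Fin p → ℝ) (u : Fin p → ℝ) (V : Fin n → Fin p → ℝ)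
    (hX : ∀ i j, X i j - xs j = u j + V i j) {a b : ℝ} (ha : 0 ≤ a) (hb : 0 ≤ b)
    (hua : ∑ _i : Fin n, ∑ j, u j ^ 2 = a ^ 2) (hVb : ∑ i, ∑ j, V i j ^ 2 = b ^ 2) :
    μbar * a ^ 2 - 2 * Lf * (a * b) ≤ ∑ i, ∑ j, (g i (X i) j - g i xs j) * (X i j - xs j) := by
  have hLip' : ∀ i (x y : Fin p → ℝ),
      ∑ j, (g i x j - g i y j) ^ 2 ≤ Lf ^ 2 * ∑ j, (x j - y j) ^ 2 := by
    intro i x y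
    have h := pow_le_pow_left₀ (Real.sqrt_nonneg _) (hLip i x y) 2
    rwa [mul_pow, Real.sq_sqrt (Finset.sum_nonneg fun _ _ => sq_nonneg _),
      Real.sq_sqrt (Finset.sum_nonneg fun _ _ => sq_nonneg _)] at h
  let z : Fin p → ℝ := fun j => xs j + u j
  have hXz : ∀ i j, X i j - z j = V i j := fun i j => by
    simp only [z]
    linarith [hX i j]
  have hzs : ∀ j, z j - xs j = u j := fun j => by simp [z]
  have hUU : μbar * a ^ 2 ≤ ∑ i, ∑ j, (g i z j - g i xs j) * u j := by
    rcases Nat.eq_zero_or_pos n with rfl | hn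
    · rw [← hua]
      simp
    · have hn' : (0 : ℝ) < n := by exact_mod_cast hn
      have h := mul_le_mul_of_nonneg_left (hRSC z) hn'.le
      simp only [hzs] at h
      rw [← hua, Finset.sum_const, card_univ, Fintype.card_fin, nsmul_eq_mul]
      calc μbar * (n * ∑ j, u j ^ 2) = n * (μbar * ∑ j, u j ^ 2) := by ring
        _ ≤ _ := h
        _ = ∑ j, (∑ i, (g i z j - g i xs j)) * u j := by
          rw [Finset.mul_sum]
          refine Finset.sum_congr rfl fun j _ => ?_
          field_simp
        _ = _ := by
          rw [Finset.sum_comm]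
          exact Finset.sum_congr rfl fun j _ => by rw [Finset.sum_mul]
  have hVV : 0 ≤ ∑ i, ∑ j, (g i (X i) j - g i z j) * V i j := by
    refine Finset.sum_nonneg fun i _ => ?_
    simpa only [hXz] using sum_gradient_mul_nonneg (hconv i) (X i) z
  have hVU : -(Lf * b * a) ≤ ∑ i, ∑ j, (g i (X i) j - g i z j) * u j := by
    refine neg_mul_le_sum_sum_mul _ (fun _ => u) (by positivity) ha ?_ hua.le
    rw [mul_pow, ← hVb, Finset.mul_sum]
    refine Finset.sum_le_sum fun i _ => ?_
    simpa only [hXz] using hLip' i (X i) z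
  have hUV : -(Lf * a * b) ≤ ∑ i, ∑ j, (g i z j - g i xs j) * V i j := by
    refine neg_mul_le_sum_sum_mul _ V (by positivity) hb ?_ hVb.le
    rw [mul_pow, ← hua, Finset.mul_sum]
    refine Finset.sum_le_sum fun i _ => ?_
    simpa only [hzs] using hLip' i z xs
  have hsplit : ∑ i, ∑ j, (g i (X i) j - g i xs j) * (X i j - xs j) =
      ∑ i, ∑ j, (g i z j - g i xs j) * u j + ∑ i, ∑ j, (g i (X i) j - g i z j) * V i j +
      ∑ i, ∑ j, (g i (X i) j - g i z j) * u j + ∑ i, ∑ j, (g i z j - g i xs j) * V i j := by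
    simp only [← Finset.sum_add_distrib]
    refine Finset.sum_congr rfl fun i _ => Finset.sum_congr rfl fun j _ => ?_
    rw [hX i j]
    ring
  rw [hsplit]
  linarith

/-- Combining the two lower bounds on the gradient term with a bound `κ b²` on the penalty. -/
lemma min_mul_le_of_lower_bounds {a b μ L γ κ T : ℝ} (ha : 0 ≤ a) (hL : 0 < L)
    (hγ : 0 < γ) (hκ : 0 ≤ κ) (hT : 0 ≤ T)
    (hT' : μ * a ^ 2 - 2 * L * (a * b) ≤ T) :
    min (μ - 2 * L * γ) (κ / (1 + 1 / γ ^ 2)) * (a ^ 2 + b ^ 2) ≤ T + κ * b ^ 2 := by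
  have hden : 0 < 1 + 1 / γ ^ 2 := by positivity
  rcases le_total b (γ * a) with h | h
  · have hκ' : κ / (1 + 1 / γ ^ 2) ≤ κ :=
      div_le_self hκ (le_add_of_nonneg_right (by positivity))
    have h₁ := mul_le_mul_of_nonneg_right
      (min_le_left (μ - 2 * L * γ) (κ / (1 + 1 / γ ^ 2))) (sq_nonneg a)
    have h₂ := mul_le_mul_of_nonneg_right
      ((min_le_right (μ - 2 * L * γ) (κ / (1 + 1 / γ ^ 2))).trans hκ') (sq_nonneg b)
    have h₃ := mul_le_mul_of_nonneg_left h (mul_nonneg hL.le ha)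
    nlinarith
  · have hab : a ^ 2 + b ^ 2 ≤ (1 + 1 / γ ^ 2) * b ^ 2 := by
      have : a ^ 2 ≤ 1 / γ ^ 2 * b ^ 2 := by
        rw [one_div_mul_eq_div, le_div_iff₀ (by positivity)]
        nlinarith [pow_le_pow_left₀ (by positivity) h 2]
      linarith
    calc _ ≤ κ / (1 + 1 / γ ^ 2) * (a ^ 2 + b ^ 2) :=
          mul_le_mul_of_nonneg_right (min_le_right _ _) (by positivity)
      _ ≤ κ / (1 + 1 / γ ^ 2) * ((1 + 1 / γ ^ 2) * b ^ 2) :=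
          mul_le_mul_of_nonneg_left hab (by positivity)
      _ = κ * b ^ 2 := by field_simp
      _ ≤ _ := by linarith

/-- If f̄ = (1/n)∑ f_i is restricted strongly convex at its minimizer
x* with constant μ̄ > 0 (each f_i convex with L_f-Lipschitz gradient), and W̃−W is
symmetric PSD with null(W̃−W) = span{𝟏}, then for α > 0 the penalized function
g(X) = ∑ f_i(x₍ᵢ₎) + (1/(4α))‖X‖²_{W̃−W} is restricted strongly convex at X* = 𝟏(x*)ᵀ
with some constant μ_g > 0; moreover μ_g ≥ min{μ̄ − 2L_fγ, λ̃min(W̃−W)/(2α(1+1/γ²))}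
for every γ ∈ (0, μ̄/(2L_f)).  (∇g(X) = ∇f(X) + (1/(2α))(W̃−W)X.) -/
theorem stmt13 {n p : ℕ}
    (f : Fin n → (Fin p → ℝ) → ℝ) (g : Fin n → (Fin p → ℝ) → (Fin p → ℝ))
    (hconv : ∀ i x y, f i x + ∑ j, g i x j * (y j - x j) ≤ f i y)
    (Lf : ℝ) (hLf : 0 < Lf)
    (hLip : ∀ i (a b : Fin p → ℝ),
      Real.sqrt (∑ j, (g i a j - g i b j) ^ 2) ≤ Lf * Real.sqrt (∑ j, (a j - b j) ^ 2))
    (xs : Fin p → ℝ)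
    (hmin : ∀ y : Fin p → ℝ, (1 / (n : ℝ)) * ∑ i, f i xs ≤ (1 / (n : ℝ)) * ∑ i, f i y)
    (μbar : ℝ) (hμbar : 0 < μbar)
    (hRSC : ∀ x : Fin p → ℝ,
      μbar * ∑ j, (x j - xs j) ^ 2 ≤
        ∑ j, ((1 / (n : ℝ)) * ∑ i, (g i x j - g i xs j)) * (x j - xs j))
    (W Wt : Matrix (Fin n) (Fin n) ℝ)
    (hMsymm : (Wt - W).IsSymm) (hMPSD : (Wt - W).PosSemidef)
    (hnull : {v : Fin n → ℝ | (Wt - W).mulVec v = 0} =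
      {v : Fin n → ℝ | ∃ c : ℝ, v = fun _ => c})
    (α : ℝ) (hα : 0 < α) :
    ∃ μg : ℝ, 0 < μg ∧
      (∀ X : Matrix (Fin n) (Fin p) ℝ,
        (let Xs : Matrix (Fin n) (Fin p) ℝ := Matrix.of (fun _ => xs)
         μg * (∑ i, ∑ j, (X i j - Xs i j) ^ 2) ≤
           ∑ i, ∑ j,
             ((g i (X i) j - g i (Xs i) j) +
               (1 / (2 * α)) * (((Wt - W) * (X - Xs)) i j)) * (X i j - Xs i j))) ∧
      (∀ γ : ℝ, 0 < γ → γ < μbar / (2 * Lf) →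
        min (μbar - 2 * Lf * γ) (lamTildeMin (Wt - W) / (2 * α * (1 + 1 / γ ^ 2))) ≤ μg) := by
  set M := Wt - W
  have hconst : ∀ c : ℝ, M *ᵥ (fun _ => c) = 0 := fun c => by
    have : (fun _ => c) ∈ {v : Fin n → ℝ | M *ᵥ v = 0} := by
      rw [hnull]
      exact ⟨c, rfl⟩
    exact this
  have hker : ∀ w, M *ᵥ w = 0 → ∃ c : ℝ, w = fun _ => c := fun w hw => by
    have : w ∈ {v : Fin n → ℝ | M *ᵥ v = 0} := hw
    rwa [hnull] at this
  have hdecomp : ∀ X : Matrix (Fin n) (Fin p) ℝ, ∃ a b T P : ℝ, 0 ≤ a ∧ 0 ≤ T ∧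
      μbar * a ^ 2 - 2 * Lf * (a * b) ≤ T ∧ 0 ≤ P ∧ lamTildeMin M * b ^ 2 ≤ P ∧
      (M = 0 → b = 0) ∧ ∑ i, ∑ j, (X i j - xs j) ^ 2 = a ^ 2 + b ^ 2 ∧
      ∑ i, ∑ j, ((g i (X i) j - g i xs j) +
        (1 / (2 * α)) * ((M * (X - (Matrix.of fun _ => xs : Matrix (Fin n) (Fin p) ℝ))) i j)) *
        (X i j - xs j) =
        T + 1 / (2 * α) * P := by
    intro X
    let u : Fin p → ℝ := fun j => (∑ i, (X i j - xs j)) / n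
    let V : Fin n → Fin p → ℝ := fun i j => X i j - xs j - u j
    have hX : ∀ i j, X i j - xs j = u j + V i j := fun i j => by simp [V]
    have hV0 : ∀ j, ∑ i, V i j = 0 := fun j => by
      simp only [V, Finset.sum_sub_distrib _ fun _ => u j, Finset.sum_const, card_univ,
        Fintype.card_fin, nsmul_eq_mul]
      rcases Nat.eq_zero_or_pos n with rfl | hn
      · simp
      · have hn' : (n : ℝ) ≠ 0 := by positivity
        simp only [u]
        rw [mul_div_cancel₀ _ hn', sub_self]
    have hua : ∑ _i : Fin n, ∑ j, u j ^ 2 = √(∑ _i : Fin n, ∑ j, u j ^ 2) ^ 2 :=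
      (Real.sq_sqrt (by positivity)).symm
    have hVb : ∑ i, ∑ j, V i j ^ 2 = √(∑ i, ∑ j, V i j ^ 2) ^ 2 :=
      (Real.sq_sqrt (by positivity)).symm
    have hcol : ∀ j, (fun i => X i j - xs j) = (fun _ => u j) + fun i => V i j := fun j =>
      funext fun i => hX i j
    refine ⟨√(∑ _i : Fin n, ∑ j, u j ^ 2), √(∑ i, ∑ j, V i j ^ 2),
      ∑ i, ∑ j, (g i (X i) j - g i xs j) * (X i j - xs j),
      ∑ j, (fun i => X i j - xs j) ⬝ᵥ M *ᵥ (fun i => X i j - xs j),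
      Real.sqrt_nonneg _,
      Finset.sum_nonneg fun i _ => sum_gradient_mul_nonneg (hconv i) (X i) xs,
      sum_gradient_mul_lower_bound hconv hLf hLip hRSC X u V hX (Real.sqrt_nonneg _)
        (Real.sqrt_nonneg _) hua hVb,
      Finset.sum_nonneg fun j _ => by simpa using hMPSD.dotProduct_mulVec_nonneg _, ?_, ?_, ?_, ?_⟩
    · rw [← hVb, Finset.sum_comm, Finset.mul_sum]
      refine Finset.sum_le_sum fun j _ => ?_
      rw [hcol j, dotProduct_mulVec_const_add hMsymm hconst]
      refine le_of_eq_of_le ?_ (lamTildeMin_mul_le hMPSD fun w hw => ?_)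
      · simp [dotProduct, sq]
      · obtain ⟨c, rfl⟩ := hker w hw
        simp [dotProduct, ← Finset.mul_sum, hV0 j]
    · intro h0
      have hVz : ∀ i j, V i j = 0 := fun i j => by
        obtain ⟨c, hc⟩ := hker (fun i => V i j) (by rw [h0, zero_mulVec])
        have hi : ∀ i, V i j = c := congrFun hc
        have hn : (n : ℝ) ≠ 0 := by exact_mod_cast i.pos.ne'
        have h := hV0 j
        simp only [hi, Finset.sum_const, card_univ, Fintype.card_fin, nsmul_eq_mul] at h
        rw [hi i]
        exact (mul_eq_zero.1 h).resolve_left hn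
      simp [hVz]
    · rw [← hua, ← hVb, Finset.sum_comm, Finset.sum_comm (f := fun _ j => u j ^ 2),
        Finset.sum_comm (f := fun i j => V i j ^ 2), ← Finset.sum_add_distrib]
      refine Finset.sum_congr rfl fun j _ => ?_
      simp only [hX]
      exact sum_add_sq_of_sum_eq_zero (u j) (hV0 j)
    · rw [Finset.mul_sum]
      simp only [add_mul, Finset.sum_add_distrib]
      congr 1
      rw [Finset.sum_comm]
      refine Finset.sum_congr rfl fun j _ => ?_
      rw [dotProduct, Finset.mul_sum]
      refine Finset.sum_congr rfl fun i _ => ?_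
      simp only [Matrix.mul_apply, mulVec, dotProduct, Matrix.sub_apply, Matrix.of_apply]
      ring
  simp only [Matrix.of_apply]
  by_cases h0 : M = 0
  · refine ⟨μbar, hμbar, fun X => ?_, fun γ hγ _ => (min_le_left _ _).trans ?_⟩
    · obtain ⟨a, b, T, P, ha, hT, hT', hP, -, hb0, hS, hR⟩ := hdecomp X
      have hP' : 0 ≤ 1 / (2 * α) * P := by positivity
      refine le_of_eq_of_le (congrArg _ hS) (le_of_le_of_eq ?_ hR.symm)
      rw [hb0 h0] at hT' ⊢
      linarith
    · nlinarith [mul_pos hLf hγ]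
  · have hlam := lamTildeMin_pos hMPSD h0
    let F : ℝ → ℝ := fun γ =>
      min (μbar - 2 * Lf * γ) (lamTildeMin M / (2 * α * (1 + 1 / γ ^ 2)))
    let A : Set ℝ := F '' Set.Ioo 0 (μbar / (2 * Lf))
    have hbdd : BddAbove A := by
      refine ⟨μbar, ?_⟩
      rintro _ ⟨γ, hγ, rfl⟩
      exact (min_le_left _ _).trans (by nlinarith [mul_pos hLf hγ.1])
    have hmem : μbar / (4 * Lf) ∈ Set.Ioo 0 (μbar / (2 * Lf)) :=
      ⟨by positivity, div_lt_div_of_pos_left hμbar (by positivity) (by linarith)⟩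
    have hpos : 0 < F (μbar / (4 * Lf)) := by
      refine lt_min ?_ (by positivity)
      have : 2 * Lf * (μbar / (4 * Lf)) = μbar / 2 := by
        field_simp
        norm_num
      linarith
    refine ⟨sSup A, hpos.trans_le (le_csSup hbdd ⟨_, hmem, rfl⟩), fun X => ?_,
      fun γ hγ hγ' => le_csSup hbdd ⟨γ, ⟨hγ, hγ'⟩, rfl⟩⟩
    obtain ⟨a, b, T, P, ha, hT, hT', hP, hPb, -, hS, hR⟩ := hdecomp X
    refine le_of_eq_of_le (congrArg _ hS) (le_of_le_of_eq ?_ hR.symm)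
    have hF : ∀ γ ∈ Set.Ioo 0 (μbar / (2 * Lf)),
        F γ * (a ^ 2 + b ^ 2) ≤ T + 1 / (2 * α) * P := by
      intro γ hγ
      have h := min_mul_le_of_lower_bounds (κ := lamTildeMin M / (2 * α)) ha hLf hγ.1
        (by positivity) hT hT'
      rw [div_div] at h
      refine h.trans (add_le_add_right ?_ T)
      calc lamTildeMin M / (2 * α) * b ^ 2 = 1 / (2 * α) * (lamTildeMin M * b ^ 2) := by ring
        _ ≤ _ := mul_le_mul_of_nonneg_left hPb (by positivity)
    rcases (by positivity : 0 ≤ a ^ 2 + b ^ 2).eq_or_lt with hz | hz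
    · rw [← hz, mul_zero]
      positivity
    · rw [← le_div_iff₀ hz]
      refine csSup_le ⟨_, _, hmem, rfl⟩ ?_
      rintro _ ⟨γ, hγ, rfl⟩
      exact (le_div_iff₀ hz).2 (hF γ hγ)
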